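/- In the von Dyck group D(a,b,c) = ⟨x, y | x^a = y^b = (xy)^c = 1⟩ with a,b,c ≥ 2, the intersection of the cyclic subgroups H = ⟨x⟩ and K = ⟨y⟩ is trivial. -/

import Mathlib

/-- Relations of the von Dyck group D(a,b,c) = ⟨x, y | x^a = y^b = (xy)^c = 1⟩. -/
def vonDyckRels (a b c : ℕ) : Set (FreeGroup (Fin 2)) :=
  {(FreeGroup.of 0) ^ a, (FreeGroup.of 1) ^ b, (FreeGroup.of 0 * FreeGroup.of 1) ^ c}

theorem vd_pow_aux {A : Type*} [Ring A] [Algebra ℂ A] (Y : A) (w v : ℂ) (hwv : w * v = 1)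
    (hY : Y * Y = (w + v) • Y - 1) (k : ℕ) :
    (w - v) • Y ^ (k + 1) = (w ^ (k + 1) - v ^ (k + 1)) • Y - (w ^ k - v ^ k) • (1 : A) := by
  induction k with
  | zero => simp
  | succ k ih =>
    rw [pow_succ Y (k + 1), ← smul_mul_assoc, ih, sub_mul, smul_mul_assoc, hY, smul_mul_assoc,
      one_mul]
    have h : w ^ (k + 1 + 1) - v ^ (k + 1 + 1)
        = (w ^ (k + 1) - v ^ (k + 1)) * (w + v) - (w ^ k - v ^ k) := by
      linear_combination (v ^ k - w ^ k) * hwv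
    rw [h]
    module

theorem vd_pow {A : Type*} [Ring A] [Algebra ℂ A] (Y : A) (b : ℕ) (hb : 2 ≤ b) (w : ℂ)
    (hw : IsPrimitiveRoot w (2 * b)) (hY : Y * Y = (w + w⁻¹) • Y - 1) : Y ^ b = -1 := by
  have h0 : w ≠ 0 := hw.ne_zero (by omega)
  have hwb : w ^ b = -1 := by
    have h1 : (w ^ b) ^ 2 = 1 := by rw [← pow_mul, mul_comm b 2]; exact hw.pow_eq_one
    have h2 : w ^ b ≠ 1 := hw.pow_ne_one_of_pos_of_lt (by omega) (by omega)
    rcases (mul_self_eq_one_iff.mp ((sq _).symm.trans h1)) with h | h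
    · exact absurd h h2
    · exact h
  have hne : w - w⁻¹ ≠ 0 := by
    intro h
    have h2 : w ^ 2 ≠ 1 := hw.pow_ne_one_of_pos_of_lt (by omega) (by omega)
    apply h2
    field_simp at h
    linear_combination h
  obtain ⟨k, rfl⟩ : ∃ k, b = k + 1 := ⟨b - 1, by omega⟩
  have := vd_pow_aux Y w w⁻¹ (mul_inv_cancel₀ h0) hY k
  have e1 : w ^ k = - w⁻¹ := by
    rw [pow_succ] at hwb
    field_simp
    linear_combination hwb
  rw [inv_pow, inv_pow, hwb, e1] at this
  have e3 : (w - w⁻¹) • Y ^ (k + 1) = (w - w⁻¹) • (-1 : A) := by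
    rw [this]
    simp [inv_neg]
    module
  exact smul_right_injective A hne e3

theorem vd_sl_pow (M : Matrix.SpecialLinearGroup (Fin 2) ℂ) (b : ℕ) (hb : 2 ≤ b) (w : ℂ)
    (hw : IsPrimitiveRoot w (2 * b)) (hM : M.1 0 0 + M.1 1 1 = w + w⁻¹) :
    MulAut.conj M ^ b = 1 := by
  have hd := M.2
  rw [Matrix.det_fin_two] at hd
  have h : M.1 ^ b = -1 := by
    apply vd_pow M.1 b hb w hw
    rw [← hM]
    ext i j
    fin_cases i <;> fin_cases j <;> simp [Matrix.mul_apply, Fin.sum_univ_two] <;>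
      first
        | linear_combination -hd
        | ring
  have h2 : M ^ b = -1 := by
    apply Subtype.ext
    rw [Matrix.SpecialLinearGroup.coe_pow, h]
    simp
  rw [← map_pow, h2]
  ext1 Z
  simp [MulAut.conj_apply]

theorem vd_core {G : Type*} [Group G] (x y : G) (a : ℕ) (ha : 2 ≤ a) (z p q s : ℂ)
    (hz : IsPrimitiveRoot z (2 * a)) (hz0 : z ≠ 0)
    (X Y : Matrix.SpecialLinearGroup (Fin 2) ℂ)
    (hX : X.1 = Matrix.diagonal ![z, z⁻¹]) (hY : Y.1 = !![p, 1; q, s])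
    (F : G →* MulAut (Matrix.SpecialLinearGroup (Fin 2) ℂ))
    (hFx : F x = MulAut.conj X) (hFy : F y = MulAut.conj Y) (hxa : x ^ a = 1) :
    Subgroup.zpowers x ⊓ Subgroup.zpowers y = ⊥ := by
  rw [eq_bot_iff]
  rintro g ⟨hx, hy⟩
  obtain ⟨m, hm⟩ := Subgroup.mem_zpowers_iff.mp hx
  obtain ⟨n, hn⟩ := Subgroup.mem_zpowers_iff.mp hy
  rw [Subgroup.mem_bot]
  obtain ⟨k, hk⟩ : ∃ k : ℕ, (k : ℤ) = m % a :=
    ⟨(m % a).toNat, Int.toNat_of_nonneg (Int.emod_nonneg _ (by omega))⟩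
  have hka : k < a := by
    have := Int.emod_lt_of_pos m (show (0 : ℤ) < a by omega)
    omega
  have hg : x ^ k = g := by
    rw [← hm, ← Int.mul_ediv_add_emod m a, ← hk, zpow_add, zpow_mul, zpow_natCast, hxa]
    simp
  have e : MulAut.conj (X ^ k) = MulAut.conj (Y ^ n) := by
    have e1 : F g = MulAut.conj X ^ k := by
      rw [← hg, map_pow, hFx]
    have e2 : F g = MulAut.conj Y ^ n := by
      rw [← hn, map_zpow, hFy]
    rw [map_pow, map_zpow, ← e1, e2]
  have e3 : X ^ k * Y = Y * X ^ k := by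
    have := DFunLike.congr_fun e Y
    rw [MulAut.conj_apply, MulAut.conj_apply, (Commute.refl Y).zpow_left n |>.eq,
      mul_inv_cancel_right] at this
    rwa [mul_inv_eq_iff_eq_mul] at this
  have e4 : z ^ k = z⁻¹ ^ k := by
    have := congrArg (fun M : Matrix.SpecialLinearGroup (Fin 2) ℂ => M.1 0 1) e3
    simpa [hX, hY, Matrix.diagonal_pow] using this
  have e5 : z ^ (2 * k) = 1 := by
    rw [two_mul, pow_add]
    nth_rewrite 2 [e4]
    rw [← mul_pow, mul_inv_cancel₀ hz0, one_pow]
  have e6 := hz.dvd_of_pow_eq_one _ e5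
  have e7 : k = 0 := by
    rcases Nat.eq_zero_or_pos k with h | h
    · exact h
    · have := Nat.le_of_dvd (by omega) e6
      omega
  rw [← hg, e7, pow_zero]

theorem vd_rel (a b c : ℕ) : (PresentedGroup.of (rels := vonDyckRels a b c) 0) ^ a = 1 := by
  have h : (PresentedGroup.mk (vonDyckRels a b c)) (FreeGroup.of 0 ^ a) = 1 :=
    PresentedGroup.one_of_mem (by simp [vonDyckRels])
  rw [map_pow] at h
  exact h

theorem vd_hom (a b c : ℕ) (ha : 2 ≤ a) (hb : 2 ≤ b) (hc : 2 ≤ c) :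
    ∃ (z p q s : ℂ) (X Y : Matrix.SpecialLinearGroup (Fin 2) ℂ),
      IsPrimitiveRoot z (2 * a) ∧ z ≠ 0 ∧ X.1 = Matrix.diagonal ![z, z⁻¹] ∧
      Y.1 = !![p, 1; q, s] ∧
      ∀ r ∈ vonDyckRels a b c, FreeGroup.lift ![MulAut.conj X, MulAut.conj Y] r = 1 := by
  obtain ⟨z, hz⟩ : ∃ z : ℂ, IsPrimitiveRoot z (2 * a) :=
    ⟨_, Complex.isPrimitiveRoot_exp (2 * a) (by omega)⟩
  obtain ⟨w, hw⟩ : ∃ z : ℂ, IsPrimitiveRoot z (2 * b) :=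
    ⟨_, Complex.isPrimitiveRoot_exp (2 * b) (by omega)⟩
  obtain ⟨u, hu⟩ : ∃ z : ℂ, IsPrimitiveRoot z (2 * c) :=
    ⟨_, Complex.isPrimitiveRoot_exp (2 * c) (by omega)⟩
  have hz0 : z ≠ 0 := hz.ne_zero (by omega)
  have hz2 : z ^ 2 - 1 ≠ 0 :=
    sub_ne_zero.mpr (hz.pow_ne_one_of_pos_of_lt (by omega) (by omega))
  obtain ⟨p, s, h1, h2⟩ : ∃ p s : ℂ, p + s = w + w⁻¹ ∧ z * p + z⁻¹ * s = u + u⁻¹ := by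
    refine ⟨(z * (u + u⁻¹) - (w + w⁻¹)) / (z ^ 2 - 1),
      (w + w⁻¹) - (z * (u + u⁻¹) - (w + w⁻¹)) / (z ^ 2 - 1), by ring, ?_⟩
    generalize w + w⁻¹ = t
    generalize u + u⁻¹ = r
    field_simp
    ring
  let X : Matrix.SpecialLinearGroup (Fin 2) ℂ :=
    ⟨Matrix.diagonal ![z, z⁻¹], by simp [Matrix.det_diagonal, Fin.prod_univ_two, hz0]⟩
  let Y : Matrix.SpecialLinearGroup (Fin 2) ℂ :=
    ⟨!![p, 1; p * s - 1, s], by simp [Matrix.det_fin_two]⟩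
  have hf : ∀ r ∈ vonDyckRels a b c, FreeGroup.lift ![MulAut.conj X, MulAut.conj Y] r = 1 := by
    intro r hr
    simp only [vonDyckRels, Set.mem_insert_iff, Set.mem_singleton_iff] at hr
    rcases hr with rfl | rfl | rfl
    · simp only [map_pow, FreeGroup.lift_apply_of]
      exact vd_sl_pow X a ha z hz (by simp [X])
    · simp only [map_pow, FreeGroup.lift_apply_of]
      exact vd_sl_pow Y b hb w hw (by simp [Y, h1])
    · simp only [map_pow, map_mul, FreeGroup.lift_apply_of]
      change (MulAut.conj X * MulAut.conj Y) ^ c = 1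
      rw [← map_mul]
      refine vd_sl_pow (X * Y) c hc u hu ?_
      rw [← h2]
      change (X.1 * Y.1) 0 0 + (X.1 * Y.1) 1 1 = _
      simp [X, Y]
  exact ⟨z, p, p * s - 1, s, X, Y, hz, hz0, rfl, rfl, hf⟩

/-- In D(a,b,c) with a,b,c ≥ 2, the cyclic subgroups H = ⟨x⟩ and K = ⟨y⟩ intersect trivially. -/
theorem stmt_0 (a b c : ℕ) (ha : 2 ≤ a) (hb : 2 ≤ b) (hc : 2 ≤ c) :
    Subgroup.zpowers (PresentedGroup.of (rels := vonDyckRels a b c) 0) ⊓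
      Subgroup.zpowers (PresentedGroup.of (rels := vonDyckRels a b c) 1) = ⊥ := by
  obtain ⟨z, p, q, s, X, Y, hz, hz0, hX, hY, hf⟩ := vd_hom a b c ha hb hc
  exact vd_core _ _ a ha z p q s hz hz0 X Y hX hY (PresentedGroup.toGroup hf)
    (PresentedGroup.toGroup.of hf) (PresentedGroup.toGroup.of hf) (vd_rel a b c)
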